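/- Let σ_x, σ_y, σ_ε be positive real numbers and set α(b) := (σ_x² + σ_ε² + σ_y²)(σ_x² + b²) − (σ_x² + σ_ε·b)². Then a real number b satisfies the fixed-point equation b·α(b) = (σ_y² + σ_ε² − b·σ_ε)·b·σ_x² if and only if b = 0 or b = σ_x²σ_ε/(σ_x² + σ_y²). In particular the equation has exactly two solutions. -/

import Mathlib

/-- The fixed-point equation `b·α(b) = (σ_y² + σ_ε² − b·σ_ε)·b·σ_x²` characterizing the
equilibrium price coefficient has exactly the two solutions `b = 0` and
`b = σ_x²σ_ε/(σ_x² + σ_y²)`. -/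
theorem fixed_point_two_solutions (σx σy σε : ℝ) (hx : 0 < σx) (hy : 0 < σy) (hε : 0 < σε) :
    (∀ b : ℝ,
      b * ((σx ^ 2 + σε ^ 2 + σy ^ 2) * (σx ^ 2 + b ^ 2) - (σx ^ 2 + σε * b) ^ 2) =
        (σy ^ 2 + σε ^ 2 - b * σε) * b * σx ^ 2 ↔
      b = 0 ∨ b = σx ^ 2 * σε / (σx ^ 2 + σy ^ 2)) ∧
    (0 : ℝ) ≠ σx ^ 2 * σε / (σx ^ 2 + σy ^ 2) := by
  have hpos : 0 < σx ^ 2 + σy ^ 2 := by positivity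
  refine ⟨fun b => ?_, (by positivity : 0 < σx ^ 2 * σε / (σx ^ 2 + σy ^ 2)).ne⟩
  rw [eq_div_iff hpos.ne', ← sub_eq_zero, ← sub_eq_zero (a := b * (σx ^ 2 + σy ^ 2))]
  have factor : b * ((σx ^ 2 + σε ^ 2 + σy ^ 2) * (σx ^ 2 + b ^ 2) - (σx ^ 2 + σε * b) ^ 2) -
      (σy ^ 2 + σε ^ 2 - b * σε) * b * σx ^ 2 =
      b ^ 2 * (b * (σx ^ 2 + σy ^ 2) - σx ^ 2 * σε) := by ring
  rw [factor, mul_eq_zero, sq_eq_zero_iff]
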